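/- arXiv:1308.0753 — 8 statements merged into one kernel-verified Lean document; each statement's English description precedes it below -/
import Mathlib

section
/- Let K ≥ 1 and ℓ_1,…,ℓ_K ≥ 1 be integers, t ≥ 0 and p ≥ 1 integers, R = Σ_{j=1}^K (ℓ_j+1), and s_k = t + kp. Let z_1,…,z_K ∈ ℂ be nonzero and a_{i,j} ∈ ℂ (0 ≤ i ≤ ℓ_j−1). Then the Jacobian matrix J of the decimated polynomial Prony map is invertible if and only if both of the following hold: (1) z_i^p ≠ z_j^p for all i ≠ j, and (2) a_{ℓ_j−1,j} ≠ 0 for all j = 1,…,K. -/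
open scoped BigOperators

noncomputable section

/-- The order-preserving bijection between lexicographically ordered block indices `(j, i)`,
`i < m j`, and `Fin (∑ j, m j)`; it sends `(j, i)` to `m 0 + ⋯ + m (j-1) + i`. -/
def finSigmaOrdEquiv {K : ℕ} (m : Fin K → ℕ) :
    (Σₗ j : Fin K, Fin (m j)) ≃o Fin (∑ j, m j) :=
  (monoEquivOfFin (Σₗ j : Fin K, Fin (m j)) (k := ∑ j, m j)
    (by change Fintype.card (Σ j : Fin K, Fin (m j)) = _; simp)).symm

/-- Encode a block index `(j, i)` as an index in `Fin (∑ j, m j)`. -/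
def finSigmaIdx {K : ℕ} (m : Fin K → ℕ) (j : Fin K) (i : Fin (m j)) :
    Fin (∑ j, m j) :=
  finSigmaOrdEquiv m ⟨j, i⟩

/-- Decode an index in `Fin (∑ j, m j)` into a block index `(j, i)`. -/
def finSigmaDec {K : ℕ} (m : Fin K → ℕ) (c : Fin (∑ j, m j)) :
    (j : Fin K) × Fin (m j) :=
  (finSigmaOrdEquiv m).symm c

end

/-- The Jacobian matrix of the decimated polynomial Prony map: rows are indexed by
`k = 0, …, R-1` (the measurement `m_{t+kp}`), columns by block indices `(j, i)` with
`i < ℓ j` labelling the unknown `a_{i,j}`, and `(j, ℓ j)` labelling the unknown `z_j`. -/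
noncomputable def pronyJacP {K : ℕ} (ℓ : Fin K → ℕ) (t p : ℕ)
    (z : Fin K → ℂ) (a : (j : Fin K) → Fin (ℓ j) → ℂ) :
    Matrix (Fin (∑ j, (ℓ j + 1))) (Fin (∑ j, (ℓ j + 1))) ℂ :=
  fun k c =>
    let ji := finSigmaDec (fun j => ℓ j + 1) c
    let s : ℕ := t + (k : ℕ) * p
    if (ji.2 : ℕ) < ℓ ji.1 then
      z ji.1 ^ s * (s : ℂ) ^ (ji.2 : ℕ)
    else
      z ji.1 ^ ((s : ℤ) - 1) * ∑ i : Fin (ℓ ji.1), a ji.1 i * (s : ℂ) ^ ((i : ℕ) + 1)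

open Polynomial in
/-- An exponential polynomial `∑ j, w j ^ k * Q j k` with distinct bases, where `Q j` has degree
less than `m j`, vanishes identically once it vanishes for all `k < ∑ j, m j`. -/
lemma eq_zero_of_sum_pow_mul_eval_eq_zero {ι F : Type*} [Fintype ι] [DecidableEq ι]
    [Field F] [CharZero F] {w : ι → F} (hw : Function.Injective w) (hw0 : ∀ j, w j ≠ 0) (N : ℕ) :
    ∀ (m : ι → ℕ) (Q : ι → F[X]), ∑ j, m j = N → (∀ j, (Q j).degree < m j) →
      (∀ k < N, ∑ j, w j ^ k * (Q j).eval (k : F) = 0) → ∀ j, Q j = 0 := by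
  induction N with
  | zero =>
    intro m Q hm hQ _ j
    have h0 : m j = 0 := by
      have := Finset.single_le_sum (f := m) (fun _ _ => Nat.zero_le _) (Finset.mem_univ j)
      omega
    have := hQ j
    rw [h0] at this
    simpa using this
  | succ N ih =>
    intro m Q hm hQ hu
    obtain ⟨i, hi⟩ : ∃ i, 0 < m i := by
      by_contra! h
      have : ∑ j, m j = 0 := Finset.sum_eq_zero fun j _ => Nat.le_zero.mp (h j)
      omega
    have key := ih (Function.update m i (m i - 1))
      (fun j => C (w j) * taylor 1 (Q j) - C (w i) * Q j) ?_ ?_ ?_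
    · have hne : ∀ j, j ≠ i → Q j = 0 := by
        intro j hj
        have h := congrArg (fun f => f.coeff (Q j).natDegree) (key j)
        simp only [coeff_sub, coeff_C_mul, coeff_zero, coeff_taylor_natDegree,
          coeff_natDegree] at h
        rw [← sub_mul] at h
        exact leadingCoeff_eq_zero.mp
          ((mul_eq_zero.mp h).resolve_left (sub_ne_zero.mpr (hw.ne hj)))
      have hshift : taylor 1 (Q i) = Q i := by
        have h := key i
        rw [← mul_sub] at h
        exact sub_eq_zero.mp ((mul_eq_zero.mp h).resolve_left (C_ne_zero.mpr (hw0 i)))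
      have h0 : (Q i).eval 0 = 0 := by
        have h := hu 0 (Nat.succ_pos N)
        rw [Finset.sum_eq_single i (fun j _ hj => by simp [hne j hj]) (by simp)] at h
        simpa using h
      have hnat : ∀ n : ℕ, (Q i).eval (n : F) = 0 := by
        intro n
        induction n with
        | zero => simpa using h0
        | succ n ihn =>
          rw [← hshift, taylor_eval] at ihn
          push_cast
          exact ihn
      have hi0 : Q i = 0 := eq_zero_of_infinite_isRoot _
        ((Set.infinite_range_of_injective (Nat.cast_injective (R := F))).mono
          (by rintro _ ⟨n, rfl⟩; exact hnat n))
      intro j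
      by_cases hj : j = i
      · exact hj ▸ hi0
      · exact hne j hj
    · have h1 := Finset.sum_update_of_mem (Finset.mem_univ i) m (m i - 1)
      have h2 := Finset.add_sum_erase Finset.univ m (Finset.mem_univ i)
      rw [← Finset.erase_eq] at h1
      omega
    · intro j
      by_cases hj : j = i
      · subst hj
        simp only [Function.update_self]
        rw [← mul_sub, degree_C_mul (hw0 j)]
        by_cases h0 : Q j = 0
        · simp [h0]
        · have hlt : (taylor 1 (Q j) - Q j).degree < (taylor 1 (Q j)).degree :=
            degree_sub_lt_left (degree_taylor _ _) (by simpa using h0) (leadingCoeff_taylor _ _)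
          rw [degree_taylor, degree_eq_natDegree h0] at hlt
          have hm := hQ j
          rw [degree_eq_natDegree h0, Nat.cast_lt] at hm
          exact hlt.trans_le (Nat.cast_le.mpr (Nat.le_sub_one_of_lt hm))
      · rw [Function.update_of_ne hj]
        refine (degree_sub_le _ _).trans_lt (max_lt ?_ ?_)
        · rw [degree_C_mul (hw0 j), degree_taylor]; exact hQ j
        · rw [degree_C_mul (hw0 i)]; exact hQ j
    · intro k hk
      have h1 := hu (k + 1) (by omega)
      have h2 := hu k (by omega)
      calc ∑ j, w j ^ k * (C (w j) * taylor 1 (Q j) - C (w i) * Q j).eval (k : F)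
          = ∑ j, w j ^ (k + 1) * (Q j).eval ((k + 1 : ℕ) : F)
              - w i * ∑ j, w j ^ k * (Q j).eval (k : F) := by
            rw [Finset.mul_sum, ← Finset.sum_sub_distrib]
            refine Finset.sum_congr rfl fun j _ => ?_
            simp only [eval_sub, eval_mul, eval_C, taylor_eval]
            push_cast
            ring
        _ = 0 := by rw [h1, h2]; simp

open Polynomial in
/-- The polynomial in the sampling point by which a block of the Prony Jacobian at node `ζ`
with amplitudes `b` acts on a vector `v`. -/
noncomputable def pronyBlockPoly {n : ℕ} (ζ : ℂ) (b : Fin n → ℂ) (v : Fin (n + 1) → ℂ) : ℂ[X] :=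
  ∑ i : Fin n, C (v i.castSucc) * X ^ (i : ℕ) +
    C (v (Fin.last n) * ζ⁻¹) * ∑ i : Fin n, C (b i) * X ^ ((i : ℕ) + 1)

open Polynomial in
lemma coeff_sum_fin_C_mul_X_pow {R : Type*} [Semiring R] {n : ℕ} (f : Fin n → R) (k : Fin n) :
    (∑ i : Fin n, C (f i) * X ^ (i : ℕ)).coeff k = f k := by
  simp [finsetSum_coeff, coeff_C_mul, coeff_X_pow, Fin.val_inj]

open Polynomial in
lemma degree_sum_fin_C_mul_X_pow_succ_lt {n : ℕ} (b : Fin n → ℂ) :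
    (∑ i : Fin n, C (b i) * X ^ ((i : ℕ) + 1)).degree < ((n + 1 : ℕ) : WithBot ℕ) := by
  refine (degree_sum_le _ _).trans_lt ((Finset.sup_lt_iff (WithBot.bot_lt_coe _)).mpr ?_)
  intro i _
  exact (degree_C_mul_X_pow_le _ _).trans_lt (Nat.cast_lt.mpr (by omega))

open Polynomial in
lemma degree_pronyBlockPoly_lt {n : ℕ} (ζ : ℂ) (b : Fin n → ℂ) (v : Fin (n + 1) → ℂ) :
    (pronyBlockPoly ζ b v).degree < ((n + 1 : ℕ) : WithBot ℕ) := by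
  refine (degree_add_le _ _).trans_lt (max_lt ?_ ?_)
  · exact (degree_sum_fin_lt _).trans (Nat.cast_lt.mpr n.lt_succ_self)
  · refine lt_of_le_of_lt ?_ (degree_sum_fin_C_mul_X_pow_succ_lt b)
    rw [← smul_eq_C_mul]
    exact degree_smul_le _ _

open Polynomial in
lemma coeff_sum_fin_C_mul_X_pow_succ_self {n : ℕ} (b : Fin n → ℂ) (hn : 0 < n) :
    (∑ i : Fin n, C (b i) * X ^ ((i : ℕ) + 1)).coeff n = b ⟨n - 1, Nat.sub_lt hn one_pos⟩ := by
  rw [finsetSum_coeff, Finset.sum_eq_single ⟨n - 1, Nat.sub_lt hn one_pos⟩]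
  · rw [coeff_C_mul, coeff_X_pow, if_pos (by simp only; omega), mul_one]
  · intro i _ hi
    have : n ≠ (i : ℕ) + 1 := fun h => hi (Fin.ext (by simp; omega))
    simp [coeff_X_pow, this]
  · simp

open Polynomial in
lemma eq_zero_of_pronyBlockPoly_eq_zero {n : ℕ} (hn : 0 < n) {ζ : ℂ} (hζ : ζ ≠ 0)
    {b : Fin n → ℂ} (hb : b ⟨n - 1, Nat.sub_lt hn one_pos⟩ ≠ 0) {v : Fin (n + 1) → ℂ}
    (h : pronyBlockPoly ζ b v = 0) : v = 0 := by
  have hlast : v (Fin.last n) = 0 := by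
    have hc := congrArg (fun f => f.coeff n) h
    simp only [pronyBlockPoly, coeff_add, coeff_C_mul, coeff_zero,
      coeff_sum_fin_C_mul_X_pow_succ_self b hn,
      coeff_eq_zero_of_degree_lt (degree_sum_fin_lt fun i : Fin n => v i.castSucc)] at hc
    simpa [hb, hζ] using hc
  funext i
  refine Fin.lastCases hlast (fun i => ?_) i
  have hc := congrArg (fun f => f.coeff (i : ℕ)) h
  rw [Pi.zero_apply]
  simpa only [pronyBlockPoly, hlast, zero_mul, C_0, add_zero, coeff_zero,
    coeff_sum_fin_C_mul_X_pow (fun i : Fin n => v i.castSucc) i] using hc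

open Polynomial in
lemma exists_ne_zero_pronyBlockPoly_eq_zero {n : ℕ} (hn : 0 < n) {ζ : ℂ} (hζ : ζ ≠ 0)
    {b : Fin n → ℂ} (hb : b ⟨n - 1, Nat.sub_lt hn one_pos⟩ = 0) :
    ∃ v ≠ 0, pronyBlockPoly ζ b v = 0 := by
  set B : ℂ[X] := ∑ i : Fin n, C (b i) * X ^ ((i : ℕ) + 1) with hB
  refine ⟨Fin.snoc (α := fun _ => ℂ) (fun i : Fin n => -B.coeff i) ζ, fun h => hζ ?_, ?_⟩
  · simpa using congrFun h (Fin.last n)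
  · ext k
    simp only [pronyBlockPoly, Fin.snoc_castSucc, Fin.snoc_last, mul_inv_cancel₀ hζ, C_1, one_mul,
      coeff_add, coeff_zero, ← hB]
    rcases lt_trichotomy k n with hk | rfl | hk
    · rw [coeff_sum_fin_C_mul_X_pow (fun i : Fin n => -B.coeff i) ⟨k, hk⟩]
      simp
    · rw [coeff_eq_zero_of_degree_lt (degree_sum_fin_lt _), hB,
        coeff_sum_fin_C_mul_X_pow_succ_self b hn, hb, add_zero]
    · rw [coeff_eq_zero_of_degree_lt ((degree_sum_fin_lt _).trans (Nat.cast_lt.mpr hk)),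
        coeff_eq_zero_of_degree_lt ((degree_sum_fin_C_mul_X_pow_succ_lt b).trans_le
          (Nat.cast_le.mpr hk)), add_zero]

/-- The decoding of block indices as an equivalence. -/
noncomputable def finSigmaDecEquiv {K : ℕ} (m : Fin K → ℕ) :
    Fin (∑ j, m j) ≃ (j : Fin K) × Fin (m j) :=
  (finSigmaOrdEquiv m).symm.toEquiv

@[simp]
lemma finSigmaDec_finSigmaDecEquiv_symm {K : ℕ} (m : Fin K → ℕ) (x : (j : Fin K) × Fin (m j)) :
    finSigmaDec m ((finSigmaDecEquiv m).symm x) = x :=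
  (finSigmaDecEquiv m).apply_symm_apply x

lemma pronyJacP_finSigmaDecEquiv_symm {K : ℕ} (ℓ : Fin K → ℕ) (t p : ℕ) (z : Fin K → ℂ)
    (a : (j : Fin K) → Fin (ℓ j) → ℂ) (k : Fin (∑ j, (ℓ j + 1))) (j : Fin K)
    (i : Fin (ℓ j + 1)) :
    pronyJacP ℓ t p z a k ((finSigmaDecEquiv fun j => ℓ j + 1).symm ⟨j, i⟩) =
      if (i : ℕ) < ℓ j then
        z j ^ (t + (k : ℕ) * p) * ((t + (k : ℕ) * p : ℕ) : ℂ) ^ (i : ℕ)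
      else
        z j ^ (((t + (k : ℕ) * p : ℕ) : ℤ) - 1) *
          ∑ i : Fin (ℓ j), a j i * ((t + (k : ℕ) * p : ℕ) : ℂ) ^ ((i : ℕ) + 1) := by
  unfold pronyJacP
  rw [finSigmaDec_finSigmaDecEquiv_symm]

lemma pronyJacP_mulVec {K : ℕ} (ℓ : Fin K → ℕ) (t p : ℕ) (z : Fin K → ℂ) (hz : ∀ j, z j ≠ 0)
    (a : (j : Fin K) → Fin (ℓ j) → ℂ) (f : ((j : Fin K) × Fin (ℓ j + 1)) → ℂ)
    (k : Fin (∑ j, (ℓ j + 1))) :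
    (pronyJacP ℓ t p z a).mulVec (f ∘ finSigmaDecEquiv fun j => ℓ j + 1) k =
      ∑ j, z j ^ (t + (k : ℕ) * p) *
        (pronyBlockPoly (z j) (a j) fun i => f ⟨j, i⟩).eval ((t + (k : ℕ) * p : ℕ) : ℂ) := by
  rw [Matrix.mulVec, dotProduct, ← (finSigmaDecEquiv fun j => ℓ j + 1).symm.sum_comp,
    Fintype.sum_sigma]
  refine Finset.sum_congr rfl fun j _ => ?_
  rw [Fin.sum_univ_castSucc]
  simp only [pronyJacP_finSigmaDecEquiv_symm, Function.comp_apply, Equiv.apply_symm_apply,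
    Fin.val_castSucc, Fin.is_lt, if_true, Fin.val_last, lt_irrefl, if_false, pronyBlockPoly,
    Polynomial.eval_add, Polynomial.eval_mul, Polynomial.eval_finsetSum, Polynomial.eval_C,
    Polynomial.eval_pow, Polynomial.eval_X]
  rw [zpow_sub_one₀ (hz j), zpow_natCast, mul_add]
  congr 1
  · rw [Finset.mul_sum]
    exact Finset.sum_congr rfl fun i _ => by ring
  · ring

theorem decimated_polynomial_prony_jacobian_invertible_iff
    {K : ℕ} (hK : 1 ≤ K) (ℓ : Fin K → ℕ) (hℓ : ∀ j, 1 ≤ ℓ j)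
    (t p : ℕ) (hp : 1 ≤ p)
    (z : Fin K → ℂ) (hz : ∀ j, z j ≠ 0)
    (a : (j : Fin K) → Fin (ℓ j) → ℂ) :
    IsUnit (pronyJacP ℓ t p z a) ↔
      ((∀ i j : Fin K, i ≠ j → z i ^ p ≠ z j ^ p) ∧
        (∀ j, a j ⟨ℓ j - 1, Nat.sub_lt (hℓ j) one_pos⟩ ≠ 0)) := by
  have hdet : IsUnit (pronyJacP ℓ t p z a) ↔
      ¬ ∃ v ≠ 0, (pronyJacP ℓ t p z a).mulVec v = 0 := by
    rw [Matrix.exists_mulVec_eq_zero_iff, Matrix.isUnit_iff_isUnit_det, isUnit_iff_ne_zero]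
  rw [hdet]
  set e := finSigmaDecEquiv (fun j => ℓ j + 1) with he
  constructor
  · refine fun hinj => ⟨fun i j hij hzp => hinj ?_, fun j haj => hinj ?_⟩
    · refine ⟨Pi.single (e.symm ⟨i, 0⟩) (z j ^ t) - Pi.single (e.symm ⟨j, 0⟩) (z i ^ t), ?_, ?_⟩
      · intro h
        have hne : e.symm ⟨i, 0⟩ ≠ e.symm ⟨j, 0⟩ :=
          e.symm.injective.ne fun h => hij (congrArg Sigma.fst h)
        have := congrFun h (e.symm ⟨i, 0⟩)
        simp [Pi.single_eq_of_ne hne, hz j] at this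
      · have hpos : ∀ j, 0 < ℓ j := hℓ
        funext k
        simp only [Matrix.mulVec_sub, Matrix.mulVec_single, Pi.sub_apply, Pi.smul_apply,
          Matrix.col_apply, he,
          pronyJacP_finSigmaDecEquiv_symm, Fin.val_zero, hpos,
          if_true, pow_zero, mul_one, Pi.zero_apply, MulOpposite.smul_eq_mul_unop,
          MulOpposite.unop_op, pow_add, mul_comm (k : ℕ) p, pow_mul, hzp]
        ring
    · obtain ⟨u, hu, hP⟩ := exists_ne_zero_pronyBlockPoly_eq_zero (hℓ j) (hz j) haj
      refine ⟨(fun x => (Pi.single j u : (j : Fin K) → Fin (ℓ j + 1) → ℂ) x.1 x.2) ∘ e, ?_, ?_⟩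
      · refine fun h => hu (funext fun i => ?_)
        have hi := congrFun h (e.symm ⟨j, i⟩)
        rw [Function.comp_apply, Equiv.apply_symm_apply] at hi
        simpa using hi
      · funext k
        rw [he, pronyJacP_mulVec ℓ t p z hz a]
        refine Finset.sum_eq_zero fun i _ => ?_
        by_cases hi : i = j
        · subst hi
          simp [hP]
        · simp [Pi.single_eq_of_ne hi, pronyBlockPoly]
  · rintro ⟨hzp, ha⟩ ⟨v, hv, hJ⟩
    refine hv (funext fun c => ?_)
    obtain ⟨f, rfl⟩ : ∃ f, v = f ∘ e := ⟨v ∘ e.symm, by ext; simp⟩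
    let u : (j : Fin K) → Fin (ℓ j + 1) → ℂ := fun j i => f ⟨j, i⟩
    let P := fun j => pronyBlockPoly (z j) (a j) (u j)
    let L : Polynomial ℂ := Polynomial.C (p : ℂ) * Polynomial.X + Polynomial.C (t : ℂ)
    have hL : L.natDegree = 1 := Polynomial.natDegree_linear (by exact_mod_cast (by omega : p ≠ 0))
    have hzero := eq_zero_of_sum_pow_mul_eval_eq_zero (w := fun j => z j ^ p)
      (fun i j hij => by_contra fun hne => hzp i j hne hij) (fun j => pow_ne_zero p (hz j)) _
      (fun j => ℓ j + 1) (fun j => Polynomial.C (z j ^ t) * (P j).comp L) rfl ?_ ?_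
    · have hP : ∀ j, P j = 0 := by
        intro j
        have h := (mul_eq_zero.mp (hzero j)).resolve_left
          (Polynomial.C_ne_zero.mpr (pow_ne_zero t (hz j)))
        rcases Polynomial.comp_eq_zero_iff.mp h with h | ⟨_, h⟩
        · exact h
        · rw [h, Polynomial.natDegree_C] at hL
          exact absurd hL zero_ne_one
      have hu : u (e c).1 = 0 :=
        eq_zero_of_pronyBlockPoly_eq_zero (hℓ _) (hz _) (ha _) (hP (e c).1)
      exact congrFun hu (e c).2
    · intro j
      rw [Polynomial.degree_C_mul (pow_ne_zero t (hz j))]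
      refine Polynomial.degree_le_natDegree.trans_lt (Nat.cast_lt.mpr ?_)
      rw [Polynomial.natDegree_comp, hL, mul_one]
      exact Nat.lt_succ_of_le (Polynomial.natDegree_le_iff_coeff_eq_zero.mpr fun n hn =>
        Polynomial.coeff_eq_zero_of_degree_lt
          ((degree_pronyBlockPoly_lt _ _ _).trans_le (Nat.cast_le.mpr hn)))
    · intro k hk
      have h := congrFun hJ ⟨k, hk⟩
      rw [he, pronyJacP_mulVec ℓ t p z hz a] at h
      rw [← show _ = (0 : ℂ) from h]
      refine Finset.sum_congr rfl fun j _ => ?_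
      simp only [L, P, Polynomial.eval_mul, Polynomial.eval_comp, Polynomial.eval_add,
        Polynomial.eval_C, Polynomial.eval_X]
      push_cast
      rw [add_comm (t : ℂ), mul_comm (k : ℂ), pow_add, mul_comm k p, pow_mul]
      ring
end

section
/- Let x_1,…,x_n ∈ ℂ and let ℓ_1,…,ℓ_n be positive integers with ℓ_1 + ⋯ + ℓ_n = N. Then the confluent Vandermonde matrix V(x_1,ℓ_1,…,x_n,ℓ_n) is invertible if and only if the nodes x_1,…,x_n are pairwise distinct. -/
open scoped BigOperators

/-- The confluent Vandermonde matrix `V(x₁,ℓ₁,…,xₙ,ℓₙ)`: rows are indexed by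
`r = 0, …, N-1`, columns by block indices `(j, k)` with `k < ℓ j`, and the entry in row `r`
and column `(j, k)` is `r(r-1)⋯(r-k+1)·x_j^{r-k}` when `r ≥ k` and `0` when `r < k`. -/
noncomputable def confVand {n : ℕ} (ℓ : Fin n → ℕ) (x : Fin n → ℂ) :
    Matrix (Fin (∑ i, ℓ i)) (Fin (∑ i, ℓ i)) ℂ :=
  fun r c =>
    let jk := finSigmaDec ℓ c
    if (jk.2 : ℕ) ≤ (r : ℕ) then
      ((r : ℕ).descFactorial (jk.2 : ℕ) : ℂ) * x jk.1 ^ ((r : ℕ) - (jk.2 : ℕ))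
    else 0

open Polynomial in
theorem confVand_apply_eq_eval {n : ℕ} (ℓ : Fin n → ℕ) (x : Fin n → ℂ)
    (r c : Fin (∑ i, ℓ i)) :
    confVand ℓ x r c =
      (derivative^[(finSigmaDec ℓ c).2] (X ^ (r : ℕ) : ℂ[X])).eval (x (finSigmaDec ℓ c).1) := by
  rw [iterate_derivative_X_pow_eq_natCast_mul]
  simp only [confVand, eval_mul, eval_natCast, eval_pow, eval_X]
  split_ifs with h
  · rfl
  · rw [Nat.descFactorial_of_lt (not_le.mp h), Nat.cast_zero, zero_mul]

open Polynomial in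
/-- Pairing a row vector with the confluent Vandermonde matrix evaluates derivatives of the
polynomial with those coefficients. -/
theorem vecMul_confVand_apply {n : ℕ} (ℓ : Fin n → ℕ) (x : Fin n → ℂ)
    (v : Fin (∑ i, ℓ i) → ℂ) (c : Fin (∑ i, ℓ i)) :
    Matrix.vecMul v (confVand ℓ x) c =
      (derivative^[(finSigmaDec ℓ c).2] (∑ r, C (v r) * X ^ (r : ℕ) : ℂ[X])).eval
        (x (finSigmaDec ℓ c).1) := by
  simp only [Matrix.vecMul, dotProduct, confVand_apply_eq_eval, iterate_derivative_sum,
    iterate_derivative_C_mul, eval_finsetSum, eval_mul, eval_C]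

theorem finSigmaDec_finSigmaIdx {K : ℕ} (m : Fin K → ℕ) (j : Fin K) (i : Fin (m j)) :
    finSigmaDec m (finSigmaIdx m j i) = ⟨j, i⟩ :=
  (finSigmaOrdEquiv m).symm_apply_apply _

open Polynomial in
/-- Uniqueness of Hermite interpolation: a polynomial of degree less than `∑ i, ℓ i` whose
derivatives of order less than `ℓ i` vanish at the distinct nodes `x i` is zero. -/
theorem eq_zero_of_iterate_derivative_isRoot {K ι : Type*} [Field K] [CharZero K] [Fintype ι]
    {ℓ : ι → ℕ} {x : ι → K} (hx : Function.Injective x) {p : K[X]}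
    (hdeg : p.degree < (∑ i, ℓ i : ℕ))
    (hroot : ∀ i, ∀ k < ℓ i, (derivative^[k] p).IsRoot (x i)) : p = 0 := by
  by_contra hp
  have hdvd : ∏ i, (X - C (x i)) ^ ℓ i ∣ p := by
    refine Finset.prod_dvd_of_coprime
      (fun i _ j _ hij => (pairwise_coprime_X_sub_C hx hij).pow) fun i _ => ?_
    rw [← le_rootMultiplicity_iff hp]
    rcases Nat.eq_zero_or_pos (ℓ i) with h | h
    · omega
    · have := (lt_rootMultiplicity_iff_isRoot_iterate_derivative (n := ℓ i - 1) hp).2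
        fun k hk => hroot i k (by omega)
      omega
  refine hp (eq_zero_of_dvd_of_degree_lt hdvd ?_)
  simpa [degree_prod] using hdeg

theorem confluent_vandermonde_invertible_iff
    {n : ℕ} (x : Fin n → ℂ) (ℓ : Fin n → ℕ) (hℓ : ∀ i, 1 ≤ ℓ i) :
    IsUnit (confVand ℓ x) ↔ Function.Injective x := by
  constructor
  · intro hu i j hij
    by_contra hne
    have hcol : finSigmaIdx ℓ i ⟨0, hℓ i⟩ ≠ finSigmaIdx ℓ j ⟨0, hℓ j⟩ := fun h =>
      hne (by simpa [finSigmaDec_finSigmaIdx] using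
        congrArg (fun c => (finSigmaDec ℓ c).1) h)
    rw [Matrix.isUnit_iff_isUnit_det] at hu
    refine hu.ne_zero (Matrix.det_zero_of_column_eq hcol fun r => ?_)
    rw [confVand_apply_eq_eval, confVand_apply_eq_eval, finSigmaDec_finSigmaIdx,
      finSigmaDec_finSigmaIdx, hij]
  · intro hx
    rw [← Matrix.vecMul_injective_iff_isUnit]
    refine (injective_iff_map_eq_zero (Matrix.vecMulLinear (confVand ℓ x))).2 fun v hv => ?_
    have hp : (∑ r, Polynomial.C (v r) * Polynomial.X ^ (r : ℕ)) = 0 := by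
      refine eq_zero_of_iterate_derivative_isRoot hx (Polynomial.degree_sum_fin_lt v)
        fun i k hk => ?_
      have h := congrFun hv (finSigmaIdx ℓ i ⟨k, hk⟩)
      rw [Matrix.vecMulLinear_apply, vecMul_confVand_apply, finSigmaDec_finSigmaIdx] at h
      exact h
    funext r
    simpa [Polynomial.finsetSum_coeff, Polynomial.coeff_X_pow, Fin.val_inj] using
      congrArg (fun p => Polynomial.coeff p (r : ℕ)) hp
end

section
/- Let z_1,…,z_K ∈ ℂ, let ℓ_1,…,ℓ_K ≥ 1 be integers with C = Σ ℓ_j, and let t ≥ 0 and p ≥ 1 be integers. For each j let Q_j be the ℓ_j×ℓ_j upper triangular matrix with entries (Q_j)_{m,n} = (−t)^{n−m} · binom(n−1, n−m) for 1 ≤ m ≤ n ≤ ℓ_j and 0 otherwise. Then each Q_j is invertible (it is unitriangular), and the Pascal–Vandermonde matrices satisfy U_{t,p}(z_1,ℓ_1,…,z_K,ℓ_K) = U_{0,p}(z_1,ℓ_1,…,z_K,ℓ_K) · diag{ z_j^t · Q_j^{−1} }_{j=1}^K, where diag{·} denotes the block-diagonal matrix with the given blocks. -/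
open scoped BigOperators

/-- The shifted decimated Pascal–Vandermonde matrix `U_{t,p}(z₁,m₁,…,z_K,m_K)`: rows are
indexed by `k = 0, …, C-1`, columns by block indices `(j, i)` with `i < m j`, and the entry in
row `k` and column `(j, i)` is `z_j^{t+kp} · (t+kp)^i`. -/
noncomputable def pascalVand {K : ℕ} (m : Fin K → ℕ) (t p : ℕ) (z : Fin K → ℂ) :
    Matrix (Fin (∑ j, m j)) (Fin (∑ j, m j)) ℂ :=
  fun k c =>
    let ji := finSigmaDec m c
    z ji.1 ^ (t + (k : ℕ) * p) * ((t + (k : ℕ) * p : ℕ) : ℂ) ^ (ji.2 : ℕ)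

/-- The block-diagonal matrix with square diagonal blocks `A j` of size `m j`. -/
noncomputable def blockDiag {K : ℕ} (m : Fin K → ℕ)
    (A : (j : Fin K) → Matrix (Fin (m j)) (Fin (m j)) ℂ) :
    Matrix (Fin (∑ j, m j)) (Fin (∑ j, m j)) ℂ :=
  fun r c =>
    let rj := finSigmaDec m r
    let cj := finSigmaDec m c
    if h : rj.1 = cj.1 then A cj.1 (h ▸ rj.2) cj.2 else 0

/-- The unipotent upper triangular matrix `Q` with one-based entries
`Q_{m,n} = (-t)^{n-m}·binom(n-1, n-m)` (zero-based: `Q_{a,b} = (-t)^{b-a}·binom(b, b-a)`). -/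
noncomputable def shiftBlock (d t : ℕ) : Matrix (Fin d) (Fin d) ℂ :=
  fun a b =>
    if (a : ℕ) ≤ (b : ℕ) then
      (-(t : ℂ)) ^ ((b : ℕ) - (a : ℕ)) * (((b : ℕ).choose ((b : ℕ) - (a : ℕ)) : ℕ) : ℂ)
    else 0

open Matrix in
theorem monomials_vecMul_shiftBlock (d t : ℕ) (x : ℂ) :
    (fun i : Fin d => x ^ (i : ℕ)) ᵥ* shiftBlock d t = fun i : Fin d => (x - t) ^ (i : ℕ) := by
  ext b
  simp only [vecMul, dotProduct, shiftBlock]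
  rw [sub_eq_add_neg, add_pow, Fin.sum_univ_eq_sum_range (fun a : ℕ => x ^ a *
    if a ≤ (b : ℕ) then (-(t : ℂ)) ^ ((b : ℕ) - a) * (((b : ℕ).choose (b - a) : ℕ) : ℂ) else 0) d]
  symm
  rw [← Finset.sum_subset (Finset.range_subset_range.2 b.isLt)]
  · refine Finset.sum_congr rfl fun a ha => ?_
    have hab : a ≤ b := Nat.lt_succ_iff.1 (Finset.mem_range.1 ha)
    rw [if_pos hab, Nat.choose_symm hab, mul_assoc]
  · intro a _ ha
    rw [if_neg (by simpa [Nat.lt_succ_iff] using ha), mul_zero]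

theorem isUnit_shiftBlock (d t : ℕ) : IsUnit (shiftBlock d t) := by
  have htri : (shiftBlock d t).BlockTriangular id := fun _ _ hab =>
    if_neg (not_le.2 (Fin.lt_def.1 hab))
  rw [Matrix.isUnit_iff_isUnit_det, Matrix.det_of_isUpperTriangular htri]
  simp [shiftBlock]

open Matrix in
theorem monomials_vecMul_shiftBlock_inv (d t : ℕ) (x : ℂ) :
    (fun i : Fin d => x ^ (i : ℕ)) ᵥ* (shiftBlock d t)⁻¹ =
      fun i : Fin d => (x + t) ^ (i : ℕ) := by
  have h := monomials_vecMul_shiftBlock d t (x + t)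
  rw [add_sub_cancel_right] at h
  rw [← h, vecMul_vecMul, mul_nonsing_inv _ ((isUnit_iff_isUnit_det _).1 (isUnit_shiftBlock d t)),
    vecMul_one]

theorem blockDiag_finSigmaIdx {K : ℕ} (m : Fin K → ℕ)
    (A : (j : Fin K) → Matrix (Fin (m j)) (Fin (m j)) ℂ) (j : Fin K) (i : Fin (m j))
    (c : Fin (∑ j, m j)) :
    blockDiag m A (finSigmaIdx m j i) c =
      if h : j = (finSigmaDec m c).1 then A (finSigmaDec m c).1 (h ▸ i) (finSigmaDec m c).2
      else 0 :=
  congrArg (fun s : (j : Fin K) × Fin (m j) => if h : s.1 = (finSigmaDec m c).1 then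
    A (finSigmaDec m c).1 (h ▸ s.2) (finSigmaDec m c).2 else 0) (finSigmaDec_finSigmaIdx m j i)

/-- A column of a product with a block-diagonal matrix only involves the block of that column. -/
theorem mul_blockDiag_apply {K : ℕ} (m : Fin K → ℕ)
    (M : Matrix (Fin (∑ j, m j)) (Fin (∑ j, m j)) ℂ)
    (A : (j : Fin K) → Matrix (Fin (m j)) (Fin (m j)) ℂ) (k c : Fin (∑ j, m j)) :
    (M * blockDiag m A) k c =
      ∑ i, M k (finSigmaIdx m (finSigmaDec m c).1 i) *
        A (finSigmaDec m c).1 i (finSigmaDec m c).2 := by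
  let e : (Σ j : Fin K, Fin (m j)) ≃ Fin (∑ j, m j) := (finSigmaOrdEquiv m).toEquiv
  have he (j) (i : Fin (m j)) : e ⟨j, i⟩ = finSigmaIdx m j i := rfl
  rw [Matrix.mul_apply, ← e.sum_comp, Fintype.sum_sigma,
    Finset.sum_eq_single (finSigmaDec m c).1]
  · refine Finset.sum_congr rfl fun i _ => ?_
    rw [he, blockDiag_finSigmaIdx, dif_pos rfl]
  · intro j _ hj
    refine Finset.sum_eq_zero fun i _ => ?_
    rw [he, blockDiag_finSigmaIdx, dif_neg hj, mul_zero]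
  · simp

theorem pascalVand_finSigmaIdx {K : ℕ} (m : Fin K → ℕ) (t p : ℕ) (z : Fin K → ℂ)
    (k : Fin (∑ j, m j)) (j : Fin K) (i : Fin (m j)) :
    pascalVand m t p z k (finSigmaIdx m j i) =
      z j ^ (t + (k : ℕ) * p) * ((t + (k : ℕ) * p : ℕ) : ℂ) ^ (i : ℕ) :=
  congrArg (fun s : (j : Fin K) × Fin (m j) => z s.1 ^ (t + (k : ℕ) * p) *
    ((t + (k : ℕ) * p : ℕ) : ℂ) ^ (s.2 : ℕ)) (finSigmaDec_finSigmaIdx m j i)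

theorem pascal_vandermonde_shift_factorization
    {K : ℕ} (z : Fin K → ℂ) (ℓ : Fin K → ℕ) (hℓ : ∀ j, 1 ≤ ℓ j)
    (t p : ℕ) (hp : 1 ≤ p) :
    (∀ j, IsUnit (shiftBlock (ℓ j) t)) ∧
      pascalVand ℓ t p z =
        pascalVand ℓ 0 p z * blockDiag ℓ (fun j => z j ^ t • (shiftBlock (ℓ j) t)⁻¹) := by
  refine ⟨fun j => isUnit_shiftBlock (ℓ j) t, ?_⟩
  ext k c
  rw [mul_blockDiag_apply]
  simp only [pascalVand_finSigmaIdx, Matrix.smul_apply, smul_eq_mul, zero_add]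
  have h := congrFun (monomials_vecMul_shiftBlock_inv (ℓ (finSigmaDec ℓ c).1) t
    (((k : ℕ) * p : ℕ) : ℂ)) (finSigmaDec ℓ c).2
  simp only [Matrix.vecMul, dotProduct] at h
  simp only [pascalVand]
  rw [add_comm t, Nat.cast_add, ← h, Finset.mul_sum, pow_add]
  exact Finset.sum_congr rfl fun i _ => by ring
end

section
/- Let z_1,…,z_K ∈ ℂ be nonzero, let ℓ_1,…,ℓ_K ≥ 1 be integers with C = Σ ℓ_j, and let t ≥ 0 and p ≥ 1 be integers. For each j let T_{z_j,ℓ_j} = diag(1, z_j, …, z_j^{ℓ_j−1}) and let S_{ℓ_j} be the ℓ_j×ℓ_j upper triangular Stirling matrix with entries (S_{ℓ_j})_{m,n} = S(n−1, m−1) for 1 ≤ m ≤ n ≤ ℓ_j (Stirling numbers of the second kind) and 0 otherwise. Then U_{t,p}(z_1,ℓ_1,…,z_K,ℓ_K) = V_{t,p}(z_1,ℓ_1,…,z_K,ℓ_K) · diag{ T_{z_j,ℓ_j} · S_{ℓ_j} }_{j=1}^K, where diag{·} denotes the block-diagonal matrix with the given blocks. -/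
open scoped BigOperators

/-- The shifted decimated confluent Vandermonde matrix `V_{t,p}(z₁,m₁,…,z_K,m_K)`: rows are
indexed by `k = 0, …, C-1`, columns by block indices `(j, i)` with `i < m j`, and the entry in
row `k` and column `(j, i)` is `(t+kp)(t+kp-1)⋯(t+kp-i+1) · z_j^{t+kp-i}` when `t+kp ≥ i`, and
`0` otherwise. -/
noncomputable def confVandTP {K : ℕ} (m : Fin K → ℕ) (t p : ℕ) (z : Fin K → ℂ) :
    Matrix (Fin (∑ j, m j)) (Fin (∑ j, m j)) ℂ :=
  fun k c =>
    let ji := finSigmaDec m c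
    let s : ℕ := t + (k : ℕ) * p
    if (ji.2 : ℕ) ≤ s then (s.descFactorial (ji.2 : ℕ) : ℂ) * z ji.1 ^ (s - (ji.2 : ℕ))
    else 0

/-- Stirling numbers of the second kind, defined by the recurrence
`S(n+1, k+1) = (k+1)·S(n, k+1) + S(n, k)`, equivalently by
`xⁿ = ∑ₖ S(n,k)·x(x−1)⋯(x−k+1)`. -/
def stirlingSecond : ℕ → ℕ → ℕ
  | 0, 0 => 1
  | 0, _ + 1 => 0
  | _ + 1, 0 => 0
  | n + 1, k + 1 => (k + 1) * stirlingSecond n (k + 1) + stirlingSecond n k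

/-- The upper triangular Stirling matrix with one-based entries `S_{m,n} = S(n-1, m-1)` for
`m ≤ n` (zero-based: entry `(a,b)` is `S(b, a)` for `a ≤ b`) and `0` otherwise. -/
noncomputable def stirlingMat (d : ℕ) : Matrix (Fin d) (Fin d) ℂ :=
  fun a b => if (a : ℕ) ≤ (b : ℕ) then ((stirlingSecond (b : ℕ) (a : ℕ) : ℕ) : ℂ) else 0

theorem stirlingSecond_eq_zero_of_lt : ∀ {n k : ℕ}, n < k → stirlingSecond n k = 0
  | _, 0, h => absurd h (Nat.not_lt_zero _)
  | 0, _ + 1, _ => by rw [stirlingSecond]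
  | n + 1, k + 1, h => by
    rw [stirlingSecond, stirlingSecond_eq_zero_of_lt (by omega : n < k + 1),
      stirlingSecond_eq_zero_of_lt (by omega : n < k), mul_zero]

theorem mul_descFactorial_eq (s k : ℕ) :
    s * s.descFactorial k = k * s.descFactorial k + s.descFactorial (k + 1) := by
  rw [Nat.descFactorial_succ]
  rcases le_or_gt k s with h | h
  · rw [← add_mul, Nat.add_sub_cancel' h]
  · simp [Nat.descFactorial_eq_zero_iff_lt.2 h]

theorem sum_range_stirlingSecond_mul_descFactorial (s n : ℕ) :
    ∑ k ∈ Finset.range (n + 1), stirlingSecond n k * s.descFactorial k = s ^ n := by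
  induction n with
  | zero => simp [stirlingSecond]
  | succ n ih =>
    have shift : ∑ k ∈ Finset.range (n + 1),
          (k + 1) * stirlingSecond n (k + 1) * s.descFactorial (k + 1) =
        ∑ k ∈ Finset.range (n + 1), k * stirlingSecond n k * s.descFactorial k := by
      have h := Finset.sum_range_succ' (fun k => k * stirlingSecond n k * s.descFactorial k) (n + 1)
      rw [Finset.sum_range_succ, stirlingSecond_eq_zero_of_lt (Nat.lt_succ_self n)] at h
      simpa using h.symm
    rw [Finset.sum_range_succ', pow_succ', ← ih, Finset.mul_sum]
    simp only [stirlingSecond, add_mul, Finset.sum_add_distrib, zero_mul, add_zero] at shift ⊢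
    rw [shift, ← Finset.sum_add_distrib]
    refine Finset.sum_congr rfl fun k _ => ?_
    rw [mul_left_comm, mul_descFactorial_eq]
    ring

theorem sum_fin_stirlingSecond_mul_descFactorial (s : ℕ) {d : ℕ} (n : Fin d) :
    ∑ k : Fin d, stirlingSecond n k * s.descFactorial k = s ^ (n : ℕ) := by
  rw [Fin.sum_univ_eq_sum_range (fun k => stirlingSecond n k * s.descFactorial k),
    ← sum_range_stirlingSecond_mul_descFactorial]
  refine (Finset.sum_subset (Finset.range_subset_range.2 n.isLt) fun k _ hk => ?_).symm
  rw [stirlingSecond_eq_zero_of_lt (by simpa [Nat.succ_le_iff] using hk), zero_mul]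

theorem stirlingMat_apply {d : ℕ} (a b : Fin d) : stirlingMat d a b = stirlingSecond b a := by
  unfold stirlingMat
  split_ifs with h
  · rfl
  · rw [stirlingSecond_eq_zero_of_lt (not_le.1 h), Nat.cast_zero]

theorem sum_mul_blockDiag {K : ℕ} (m : Fin K → ℕ)
    (A : (j : Fin K) → Matrix (Fin (m j)) (Fin (m j)) ℂ)
    (f : ((j : Fin K) × Fin (m j)) → ℂ) (c : Fin (∑ j, m j)) :
    ∑ r, f (finSigmaDec m r) * blockDiag m A r c =
      ∑ i, f ⟨(finSigmaDec m c).1, i⟩ * A (finSigmaDec m c).1 i (finSigmaDec m c).2 := by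
  let e : Fin (∑ j, m j) ≃ ((j : Fin K) × Fin (m j)) := (finSigmaOrdEquiv m).symm.toEquiv
  unfold blockDiag
  generalize finSigmaDec m c = q
  obtain ⟨j, b⟩ := q
  refine (e.sum_comp fun x : (j : Fin K) × Fin (m j) => f x *
    if h : x.1 = j then A j (h ▸ x.2) b else 0).trans ?_
  rw [Fintype.sum_sigma, Finset.sum_eq_single j]
  · simp
  · intro k _ hk
    simp [hk]
  · simp

theorem pascal_vandermonde_confluent_factorization
    {K : ℕ} (z : Fin K → ℂ) (hz : ∀ j, z j ≠ 0)
    (ℓ : Fin K → ℕ) (hℓ : ∀ j, 1 ≤ ℓ j)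
    (t p : ℕ) (hp : 1 ≤ p) :
    pascalVand ℓ t p z =
      confVandTP ℓ t p z *
        blockDiag ℓ (fun j =>
          (Matrix.diagonal fun i : Fin (ℓ j) => z j ^ (i : ℕ)) * stirlingMat (ℓ j)) := by
  ext k c
  let s : ℕ := t + (k : ℕ) * p
  rw [Matrix.mul_apply]
  refine Eq.trans ?_ (sum_mul_blockDiag ℓ _ (fun x => if (x.2 : ℕ) ≤ s then
    (s.descFactorial (x.2 : ℕ) : ℂ) * z x.1 ^ (s - (x.2 : ℕ)) else 0) c).symm
  change z (finSigmaDec ℓ c).1 ^ s * (s : ℂ) ^ ((finSigmaDec ℓ c).2 : ℕ) = _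
  generalize finSigmaDec ℓ c = q
  obtain ⟨j, b⟩ := q
  rw [← Nat.cast_pow, ← sum_fin_stirlingSecond_mul_descFactorial, Nat.cast_sum, Finset.mul_sum]
  refine Finset.sum_congr rfl fun i _ => ?_
  rw [Matrix.diagonal_mul, stirlingMat_apply]
  dsimp only
  split_ifs with h
  · rw [← pow_sub_mul_pow (z j) h]
    push_cast
    ring
  · simp [Nat.descFactorial_eq_zero_iff_lt.2 (not_le.1 h)]
end

section
/- Let z_1,…,z_K ∈ ℂ be nonzero, let ℓ_1,…,ℓ_K ≥ 1 be integers with C = Σ ℓ_j, let a_{i,j} ∈ ℂ (0 ≤ i ≤ ℓ_j−1), and let t ≥ 0 and p ≥ 1 be integers. Define the confluent Prony measurements m_s = Σ_{j=1}^K Σ_{i=0}^{ℓ_j−1} a_{i,j} · s(s−1)⋯(s−i+1) · z_j^{s−i} for integers s ≥ 0, and let M be the C×C Hankel data matrix with entries M_{k,k'} = m_{t + (k+k')p} for 0 ≤ k, k' ≤ C−1. For each j let A_j be the ℓ_j×ℓ_j matrix with entries (A_j)_{m,n} = binom(m+n−2, n−1) · a_{m+n−2, j} when m+n−2 ≤ ℓ_j−1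 and 0 otherwise (indices 1-based). Then M = V_{t,p}(z_1,ℓ_1,…,z_K,ℓ_K) · diag{A_j}_{j=1}^K · V_{0,p}(z_1,ℓ_1,…,z_K,ℓ_K)^T. -/
open scoped BigOperators

/-- The coefficient block `A_j` with one-based entries
`(A_j)_{m,n} = binom(m+n-2, n-1)·a_{m+n-2}` when `m+n-2 ≤ d-1` and `0` otherwise
(zero-based: entry `(m,n)` is `binom(m+n, n)·a_{m+n}` when `m+n < d`). -/
noncomputable def coefBlock (d : ℕ) (a : Fin d → ℂ) : Matrix (Fin d) (Fin d) ℂ :=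
  fun m n =>
    if h : (m : ℕ) + (n : ℕ) < d then
      ((((m : ℕ) + (n : ℕ)).choose (n : ℕ) : ℕ) : ℂ) * a ⟨(m : ℕ) + (n : ℕ), h⟩
    else 0

/-- The confluent Prony measurement `m_s = ∑_j ∑_i a_{i,j} (s)_i z_j^{s-i}` (integer powers of
the nonzero nodes, `(s)_i` the falling factorial). -/
noncomputable def confMeas {K : ℕ} (ℓ : Fin K → ℕ) (z : Fin K → ℂ)
    (a : (j : Fin K) → Fin (ℓ j) → ℂ) (s : ℕ) : ℂ :=
  ∑ j, ∑ i : Fin (ℓ j),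
    a j i * (s.descFactorial (i : ℕ) : ℂ) * z j ^ ((s : ℤ) - (i : ℕ))

/-- Vandermonde's identity for falling factorials. -/
lemma add_descFactorial_eq_sum_antidiagonal (s u i : ℕ) :
    (s + u).descFactorial i = ∑ x ∈ Finset.HasAntidiagonal.antidiagonal i,
      (x.1 + x.2).choose x.2 * (s.descFactorial x.1 * u.descFactorial x.2) := by
  rw [Nat.descFactorial_eq_factorial_mul_choose, Nat.add_choose_eq, Finset.mul_sum]
  refine Finset.sum_congr rfl fun x hx => ?_
  obtain rfl := Finset.HasAntidiagonal.mem_antidiagonal.1 hx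
  rw [Nat.descFactorial_eq_factorial_mul_choose, Nat.descFactorial_eq_factorial_mul_choose,
    ← Nat.add_choose_mul_factorial_mul_factorial x.1 x.2]
  ring

lemma sum_range_antidiagonal_eq_sum_sum_ite {M : Type*} [AddCommMonoid M]
    (d : ℕ) (G : ℕ → ℕ → M) :
    ∑ i ∈ Finset.range d, ∑ x ∈ Finset.HasAntidiagonal.antidiagonal i, G x.1 x.2 =
      ∑ m ∈ Finset.range d, ∑ n ∈ Finset.range d, if m + n < d then G m n else 0 := by
  rw [← Finset.sum_product', ← Finset.sum_filter (fun x : ℕ × ℕ => x.1 + x.2 < d)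
    (fun x => G x.1 x.2), ← Finset.sum_fiberwise_of_maps_to (t := Finset.range d)
    (g := fun x : ℕ × ℕ => x.1 + x.2)]
  · refine Finset.sum_congr rfl fun i hi => Finset.sum_congr ?_ fun _ _ => rfl
    ext x
    simp only [Finset.HasAntidiagonal.mem_antidiagonal, Finset.mem_filter, Finset.mem_product,
      Finset.mem_range] at hi ⊢
    omega
  · intro x hx
    simpa using (Finset.mem_filter.1 hx).2

/-- The contribution of a single nonzero node to a measurement at `s + u` is the bilinear form
of its coefficient block. -/
lemma sum_descFactorial_mul_zpow_eq_coefBlock (d : ℕ) (a : Fin d → ℂ) {w : ℂ} (hw : w ≠ 0)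
    (s u : ℕ) :
    ∑ i : Fin d, a i * ((s + u).descFactorial (i : ℕ) : ℂ) * w ^ (((s + u : ℕ) : ℤ) - (i : ℕ)) =
      ∑ m : Fin d, ∑ n : Fin d, ((s.descFactorial (m : ℕ) : ℂ) * w ^ ((s : ℤ) - (m : ℕ))) *
        coefBlock d a m n * ((u.descFactorial (n : ℕ) : ℂ) * w ^ ((u : ℤ) - (n : ℕ))) := by
  let b : ℕ → ℂ := fun i => if h : i < d then a ⟨i, h⟩ else 0
  let G : ℕ → ℕ → ℂ := fun m n => ((s.descFactorial m : ℂ) * w ^ ((s : ℤ) - m)) *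
    (((m + n).choose n : ℂ) * b (m + n)) * ((u.descFactorial n : ℂ) * w ^ ((u : ℤ) - n))
  have hl : ∀ i : Fin d,
      a i * ((s + u).descFactorial (i : ℕ) : ℂ) * w ^ (((s + u : ℕ) : ℤ) - (i : ℕ)) =
        ∑ x ∈ Finset.HasAntidiagonal.antidiagonal (i : ℕ), G x.1 x.2 := by
    intro i
    rw [add_descFactorial_eq_sum_antidiagonal]
    push_cast
    rw [Finset.mul_sum, Finset.sum_mul]
    refine Finset.sum_congr rfl fun x hx => ?_
    have hx := Finset.HasAntidiagonal.mem_antidiagonal.1 hx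
    have hb : b (x.1 + x.2) = a i := by simp [b, hx]
    have he : (s : ℤ) + u - (i : ℕ) = (s - x.1) + (u - x.2) := by omega
    simp only [G, hb]
    rw [he, zpow_add₀ hw]
    ring
  have hr : ∀ m n : Fin d, ((s.descFactorial (m : ℕ) : ℂ) * w ^ ((s : ℤ) - (m : ℕ))) *
        coefBlock d a m n * ((u.descFactorial (n : ℕ) : ℂ) * w ^ ((u : ℤ) - (n : ℕ))) =
      if (m : ℕ) + n < d then G m n else 0 := by
    intro m n
    by_cases h : (m : ℕ) + n < d <;> simp [coefBlock, G, b, h]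
  simp_rw [hl, hr]
  rw [Fin.sum_univ_eq_sum_range (fun i => ∑ x ∈ Finset.HasAntidiagonal.antidiagonal i, G x.1 x.2),
    sum_range_antidiagonal_eq_sum_sum_ite, ← Fin.sum_univ_eq_sum_range]
  refine Finset.sum_congr rfl fun m _ => ?_
  rw [← Fin.sum_univ_eq_sum_range (fun n => if (m : ℕ) + n < d then G m n else 0)]

lemma sum_comp_finSigmaDec {K : ℕ} {M : Type*} [AddCommMonoid M] (m : Fin K → ℕ)
    (f : ((j : Fin K) × Fin (m j)) → M) :
    ∑ c, f (finSigmaDec m c) = ∑ j, ∑ i, f ⟨j, i⟩ := by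
  rw [← Fintype.sum_sigma]
  exact (finSigmaOrdEquiv m).symm.toEquiv.sum_comp f

lemma confVandTP_apply {K : ℕ} (m : Fin K → ℕ) (t p : ℕ) (z : Fin K → ℂ)
    (k c : Fin (∑ j, m j)) :
    confVandTP m t p z k c =
      ((t + (k : ℕ) * p).descFactorial ((finSigmaDec m c).2 : ℕ) : ℂ) *
        z (finSigmaDec m c).1 ^ (((t + (k : ℕ) * p : ℕ) : ℤ) - ((finSigmaDec m c).2 : ℕ)) := by
  simp only [confVandTP]
  split_ifs with h
  · rw [← Nat.cast_sub h, zpow_natCast]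
  · rw [Nat.descFactorial_of_lt (not_le.1 h), Nat.cast_zero, zero_mul]

/-- A bilinear form with block-diagonal matrix is the sum of the forms of the blocks. -/
lemma sum_sum_mul_blockDiag_mul {K : ℕ} (m : Fin K → ℕ)
    (A : (j : Fin K) → Matrix (Fin (m j)) (Fin (m j)) ℂ)
    (v w : ((j : Fin K) × Fin (m j)) → ℂ) :
    ∑ c, (∑ r, v (finSigmaDec m r) * blockDiag m A r c) * w (finSigmaDec m c) =
      ∑ j, ∑ r, ∑ c, v ⟨j, r⟩ * A j r c * w ⟨j, c⟩ := by
  let B : ((j : Fin K) × Fin (m j)) → ((j : Fin K) × Fin (m j)) → ℂ :=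
    fun r c => if h : r.1 = c.1 then A c.1 (h ▸ r.2) c.2 else 0
  have hB : ∀ r c, blockDiag m A r c = B (finSigmaDec m r) (finSigmaDec m c) := fun _ _ => rfl
  simp_rw [hB]
  rw [sum_comp_finSigmaDec m (fun c => (∑ r, v (finSigmaDec m r) * B (finSigmaDec m r) c) * w c)]
  refine Finset.sum_congr rfl fun j _ => ?_
  rw [Finset.sum_comm]
  refine Finset.sum_congr rfl fun c _ => ?_
  rw [sum_comp_finSigmaDec m (fun r => v r * B r ⟨j, c⟩), Finset.sum_eq_single j]
  · simp [B, Finset.sum_mul]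
  · intro j' _ h
    simp [B, h]
  · simp

theorem confluent_hankel_factorization
    {K : ℕ} (z : Fin K → ℂ) (hz : ∀ j, z j ≠ 0)
    (ℓ : Fin K → ℕ) (hℓ : ∀ j, 1 ≤ ℓ j)
    (a : (j : Fin K) → Fin (ℓ j) → ℂ)
    (t p : ℕ) (hp : 1 ≤ p) :
    (Matrix.of fun k k' : Fin (∑ j, ℓ j) =>
        confMeas ℓ z a (t + ((k : ℕ) + (k' : ℕ)) * p)) =
      confVandTP ℓ t p z * blockDiag ℓ (fun j => coefBlock (ℓ j) (a j)) *
        (confVandTP ℓ 0 p z).transpose := by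
  ext k k'
  simp only [Matrix.of_apply, Matrix.mul_apply, Matrix.transpose_apply, confVandTP_apply]
  rw [sum_sum_mul_blockDiag_mul ℓ _
    (fun x => ((t + (k : ℕ) * p).descFactorial (x.2 : ℕ) : ℂ) *
      z x.1 ^ (((t + (k : ℕ) * p : ℕ) : ℤ) - (x.2 : ℕ)))
    (fun x => ((0 + (k' : ℕ) * p).descFactorial (x.2 : ℕ) : ℂ) *
      z x.1 ^ (((0 + (k' : ℕ) * p : ℕ) : ℤ) - (x.2 : ℕ)))]
  have hs : t + ((k : ℕ) + (k' : ℕ)) * p = (t + (k : ℕ) * p) + (0 + (k' : ℕ) * p) := by ring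
  rw [confMeas, hs]
  exact Finset.sum_congr rfl fun j _ =>
    sum_descFactorial_mul_zpow_eq_coefBlock (ℓ j) (a j) (hz j) _ _
end

section
/- Let z_1,…,z_K ∈ ℂ, let ℓ_1,…,ℓ_K ≥ 1 be integers with C = Σ ℓ_j, let a_{i,j} ∈ ℂ (0 ≤ i ≤ ℓ_j−1), and let t ≥ 0 and p ≥ 1 be integers. Define the polynomial Prony measurements m_s = Σ_{j=1}^K z_j^{s} Σ_{i=0}^{ℓ_j−1} a_{i,j} s^i for integers s ≥ 0, and let M be the C×C Hankel data matrix with entries M_{k,k'} = m_{t + (k+k')p} for 0 ≤ k, k' ≤ C−1. For each j let A_j be the ℓ_j×ℓ_j matrix with entries (A_j)_{m,n} = binom(m+n−2, n−1) · a_{m+n−2, j} when m+n−2 ≤ ℓ_j−1 and 0 otherwise (indices 1-based). Then M = U_{t,p}(z_1,ℓ_1,…,z_K,ℓ_K) · diag{A_j}_{j=1}^K · U_{0,p}(z_1,ℓ_1,…,z_K,ℓ_K)^T. -/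
open scoped BigOperators

/-- The polynomial Prony measurement `m_s = ∑_j z_j^s ∑_i a_{i,j} s^i`. -/
noncomputable def polyMeas {K : ℕ} (ℓ : Fin K → ℕ) (z : Fin K → ℂ)
    (a : (j : Fin K) → Fin (ℓ j) → ℂ) (s : ℕ) : ℂ :=
  ∑ j, z j ^ s * ∑ i : Fin (ℓ j), a j i * (s : ℂ) ^ (i : ℕ)

/-- A sum over flattened indices is the iterated sum over blocks. -/
theorem sum_finSigmaDec {K : ℕ} (m : Fin K → ℕ) {R : Type*} [AddCommMonoid R]
    (f : ((j : Fin K) × Fin (m j)) → R) :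
    ∑ c, f (finSigmaDec m c) = ∑ j, ∑ i, f ⟨j, i⟩ := by
  rw [← Fintype.sum_sigma]
  exact Equiv.sum_comp (finSigmaOrdEquiv m).symm.toEquiv f

/-- The bilinear form of `coefBlock d a` on power vectors evaluates the polynomial with
coefficients `a` at the sum of the two points. -/
theorem sum_coefBlock (d : ℕ) (a : Fin d → ℂ) (x y : ℂ) :
    ∑ n : Fin d, ∑ m : Fin d, x ^ (m : ℕ) * coefBlock d a m n * y ^ (n : ℕ) =
      ∑ i : Fin d, a i * (x + y) ^ (i : ℕ) := by
  obtain ⟨b, rfl⟩ : ∃ b : ℕ → ℂ, a = fun i : Fin d => b i :=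
    ⟨fun i => if h : i < d then a ⟨i, h⟩ else 0, by ext i; simp⟩
  let f : ℕ → ℕ → ℂ := fun m n => x ^ m * (((m + n).choose n : ℕ) * b (m + n)) * y ^ n
  have entry (m n : Fin d) : x ^ (m : ℕ) * coefBlock d (fun i : Fin d => b i) m n * y ^ (n : ℕ) =
      if (m : ℕ) + n < d then f m n else 0 := by
    unfold coefBlock
    split_ifs <;> simp [f]
  simp_rw [entry]
  rw [Finset.sum_comm,
    Fin.sum_univ_eq_sum_range (fun i => b i * (x + y) ^ i) d]
  have inner (m : ℕ) : ∑ n : Fin d, (if m + (n : ℕ) < d then f m n else 0) =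
      ∑ n ∈ Finset.range (d - m), f m n := by
    rw [Fin.sum_univ_eq_sum_range (fun n => if m + n < d then f m n else 0) d,
      ← Finset.sum_filter]
    congr 1
    ext n
    simp only [Finset.mem_filter, Finset.mem_range]
    omega
  simp_rw [inner]
  rw [Fin.sum_univ_eq_sum_range (fun m => ∑ n ∈ Finset.range (d - m), f m n) d,
    ← Finset.sum_range_diag_flip]
  refine Finset.sum_congr rfl fun i _ => ?_
  rw [add_pow, Finset.mul_sum]
  refine Finset.sum_congr rfl fun k hk => ?_
  have hki : k ≤ i := Nat.lt_succ_iff.mp (Finset.mem_range.mp hk)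
  simp only [f, Nat.add_sub_cancel' hki, Nat.choose_symm hki]
  ring

theorem polynomial_hankel_factorization
    {K : ℕ} (z : Fin K → ℂ)
    (ℓ : Fin K → ℕ) (hℓ : ∀ j, 1 ≤ ℓ j)
    (a : (j : Fin K) → Fin (ℓ j) → ℂ)
    (t p : ℕ) (hp : 1 ≤ p) :
    (Matrix.of fun k k' : Fin (∑ j, ℓ j) =>
        polyMeas ℓ z a (t + ((k : ℕ) + (k' : ℕ)) * p)) =
      pascalVand ℓ t p z * blockDiag ℓ (fun j => coefBlock (ℓ j) (a j)) *
        (pascalVand ℓ 0 p z).transpose := by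
  ext k k'
  rw [Matrix.mul_apply]
  simp only [Matrix.mul_apply, Matrix.of_apply, Matrix.transpose_apply, pascalVand]
  simp_rw [sum_mul_blockDiag ℓ (fun j => coefBlock (ℓ j) (a j))
    (fun q => z q.1 ^ (t + (k : ℕ) * p) * ((t + (k : ℕ) * p : ℕ) : ℂ) ^ (q.2 : ℕ))]
  rw [sum_finSigmaDec ℓ fun q =>
    (∑ i : Fin (ℓ q.1), z q.1 ^ (t + (k : ℕ) * p) * ((t + (k : ℕ) * p : ℕ) : ℂ) ^ (i : ℕ) *
      coefBlock (ℓ q.1) (a q.1) i q.2) *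
    (z q.1 ^ (0 + (k' : ℕ) * p) * ((0 + (k' : ℕ) * p : ℕ) : ℂ) ^ (q.2 : ℕ))]
  refine Finset.sum_congr rfl fun j _ => ?_
  have split : t + ((k : ℕ) + (k' : ℕ)) * p = (t + k * p) + (0 + k' * p) := by ring
  rw [split, Nat.cast_add, ← sum_coefBlock, pow_add, Finset.mul_sum]
  refine Finset.sum_congr rfl fun n _ => ?_
  rw [Finset.mul_sum, Finset.sum_mul]
  refine Finset.sum_congr rfl fun m _ => ?_
  ring
end

section
/- Let K ≥ 1 and ℓ_1,…,ℓ_K ≥ 1 be integers, t ≥ 0 and p ≥ 1 integers, R = Σ_{j=1}^K (ℓ_j+1), and s_k = t + kp. Let z_1,…,z_K ∈ ℂ be nonzero and a_{i,j} ∈ ℂ (0 ≤ i ≤ ℓ_j−1). For each j let E_j be the (ℓ_j+1)×(ℓ_j+1) matrix which agrees with the identity matrix in its first ℓ_j columns and whose last column is (0, a_{0,j}/z_j, a_{1,j}/z_j, …, a_{ℓ_j−1,j}/z_j)^T. Then the Jacobian matrix J of the decimated polynomial Prony map factorizes as J = U_{t,p}(z_1, ℓ_1+1, …, z_K, ℓ_K+1)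 · diag{E_j}_{j=1}^K, where diag{·} denotes the block-diagonal matrix with the given blocks. -/
open scoped BigOperators

/-- The block `E_j`: an `(ℓ+1)×(ℓ+1)` matrix agreeing with the identity in its first `ℓ`
columns, with last column `(0, a₀/z, a₁/z, …, a_{ℓ-1}/z)ᵀ`. -/
noncomputable def coeffJacBlock (d : ℕ) (zj : ℂ) (a : Fin d → ℂ) :
    Matrix (Fin (d + 1)) (Fin (d + 1)) ℂ :=
  fun m n =>
    if (n : ℕ) < d then (if m = n then 1 else 0)
    else if hm : (m : ℕ) = 0 then 0
    else a ⟨(m : ℕ) - 1, by have := m.isLt; omega⟩ / zj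

theorem pascalVand_mul_blockDiag_apply {K : ℕ} (m : Fin K → ℕ) (t p : ℕ) (z : Fin K → ℂ)
    (A : (j : Fin K) → Matrix (Fin (m j)) (Fin (m j)) ℂ) (k c : Fin (∑ j, m j)) :
    (pascalVand m t p z * blockDiag m A) k c =
      ∑ i : Fin (m (finSigmaDec m c).1),
        z (finSigmaDec m c).1 ^ (t + (k : ℕ) * p) *
          ((t + (k : ℕ) * p : ℕ) : ℂ) ^ (i : ℕ) *
          A (finSigmaDec m c).1 i (finSigmaDec m c).2 := by
  let e : Fin (∑ j, m j) ≃ (j : Fin K) × Fin (m j) := (finSigmaOrdEquiv m).symm.toEquiv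
  have key : ∀ q : (j : Fin K) × Fin (m j),
      (∑ r : (j : Fin K) × Fin (m j),
        z r.1 ^ (t + (k : ℕ) * p) * ((t + (k : ℕ) * p : ℕ) : ℂ) ^ (r.2 : ℕ) *
          (if h : r.1 = q.1 then A q.1 (h ▸ r.2) q.2 else 0)) =
      ∑ i : Fin (m q.1), z q.1 ^ (t + (k : ℕ) * p) *
        ((t + (k : ℕ) * p : ℕ) : ℂ) ^ (i : ℕ) * A q.1 i q.2 := by
    rintro ⟨j, n⟩
    rw [Fintype.sum_sigma, Finset.sum_eq_single j]
    · simp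
    · intro b _ hb
      simp [hb]
    · simp
  rw [Matrix.mul_apply, ← key]
  exact Fintype.sum_equiv e _ _ fun _ => rfl

theorem sum_mul_coeffJacBlock (d : ℕ) (s : ℕ) {w : ℂ} (hw : w ≠ 0) (a : Fin d → ℂ)
    (n : Fin (d + 1)) :
    ∑ i : Fin (d + 1), w ^ s * (s : ℂ) ^ (i : ℕ) * coeffJacBlock d w a i n =
      if (n : ℕ) < d then w ^ s * (s : ℂ) ^ (n : ℕ)
      else w ^ ((s : ℤ) - 1) * ∑ i : Fin d, a i * (s : ℂ) ^ ((i : ℕ) + 1) := by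
  by_cases hn : (n : ℕ) < d
  · simp [coeffJacBlock, hn]
  · have h_zero : coeffJacBlock d w a 0 n = 0 := by
      unfold coeffJacBlock
      rw [if_neg hn, dif_pos (Fin.val_zero _)]
    have h_succ (i : Fin d) : coeffJacBlock d w a i.succ n = a i / w := by
      unfold coeffJacBlock
      rw [if_neg hn, dif_neg (by simp)]
      rfl
    rw [if_neg hn, Fin.sum_univ_succ, zpow_sub_one₀ hw, zpow_natCast, Finset.mul_sum, h_zero,
      mul_zero, zero_add]
    refine Finset.sum_congr rfl fun i _ => ?_
    rw [h_succ, Fin.val_succ]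
    ring

theorem polynomial_prony_jacobian_factorization
    {K : ℕ} (hK : 1 ≤ K) (ℓ : Fin K → ℕ) (hℓ : ∀ j, 1 ≤ ℓ j)
    (t p : ℕ) (hp : 1 ≤ p)
    (z : Fin K → ℂ) (hz : ∀ j, z j ≠ 0)
    (a : (j : Fin K) → Fin (ℓ j) → ℂ) :
    pronyJacP ℓ t p z a =
      pascalVand (fun j => ℓ j + 1) t p z *
        blockDiag (fun j => ℓ j + 1) (fun j => coeffJacBlock (ℓ j) (z j) (a j)) := by
  ext k c
  rw [pascalVand_mul_blockDiag_apply]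
  exact (sum_mul_coeffJacBlock _ _ (hz _) _ _).symm
end

section
/- Let α be a real number with 0 < α < π. Then for every natural number n there exists a natural number p > n such that |sin(p·α)| > 1/2. -/
theorem Real.half_lt_sin {x : ℝ} (h₁ : Real.pi / 6 < x) (h₂ : x < 5 * Real.pi / 6) :
    1 / 2 < Real.sin x := by
  have hpi := Real.pi_pos
  rw [← Real.cos_pi_div_three, ← Real.cos_sub_pi_div_two, ← Real.cos_abs (x - Real.pi / 2)]
  apply Real.cos_lt_cos_of_nonneg_of_le_pi (abs_nonneg _) (by linarith)
  rw [abs_lt]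
  constructor <;> linarith

theorem exists_large_half_lt_abs_sin_of_le_pi_div_two {a : ℝ} (ha : 0 < a)
    (ha' : a ≤ Real.pi / 2) (n : ℕ) :
    ∃ p : ℕ, n < p ∧ 1 / 2 < |Real.sin ((p : ℝ) * a)| := by
  have hpi := Real.pi_pos
  set t : ℝ := n * Real.pi + Real.pi / 6 with ht
  have htpos : 0 < t := by positivity
  have hlower : t < (⌊t / a⌋₊ + 1 : ℕ) * a := by
    rw [← div_lt_iff₀ ha]
    exact_mod_cast Nat.lt_floor_add_one (t / a)
  have hupper : (⌊t / a⌋₊ + 1 : ℕ) * a ≤ t + a := by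
    have h := (le_div_iff₀ ha).1 (Nat.floor_le (div_pos htpos ha).le)
    push_cast
    linarith
  refine ⟨⌊t / a⌋₊ + 1, ?_, ?_⟩
  · refine Nat.lt_succ_of_le (Nat.le_floor ?_)
    rw [le_div_iff₀ ha]
    have : (n : ℝ) * a ≤ n * Real.pi := by gcongr; linarith
    linarith
  · have h := Real.half_lt_sin (x := (⌊t / a⌋₊ + 1 : ℕ) * a - n * Real.pi)
      (by linarith) (by linarith)
    rw [Real.sin_sub_nat_mul_pi] at h
    simpa [abs_mul] using h.trans_le (le_abs_self _)

/-- For `0 < α < π` there exist arbitrarily large natural numbers `p` with `|sin (pα)| > 1/2`. -/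
theorem exists_large_p_sin_gt_half (α : ℝ) (hα0 : 0 < α) (hαπ : α < Real.pi) (n : ℕ) :
    ∃ p : ℕ, n < p ∧ 1 / 2 < |Real.sin ((p : ℝ) * α)| := by
  rcases le_total α (Real.pi / 2) with h | h
  · exact exists_large_half_lt_abs_sin_of_le_pi_div_two hα0 h n
  · obtain ⟨p, hp, hsin⟩ := exists_large_half_lt_abs_sin_of_le_pi_div_two
      (sub_pos.2 hαπ) (by linarith) n
    refine ⟨p, hp, ?_⟩
    rw [mul_sub, Real.sin_nat_mul_pi_sub] at hsin
    simpa [abs_mul] using hsin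
end
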